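/- arXiv:2303.08583 — 2 statements merged into one kernel-verified Lean document; each statement's English description precedes it below -/
import Mathlib

section
/- For every natural number m and every commutative ring D, the covariance structure of degree m over D, i.e. the set C of triples equipped with the operations +^C and *^C, the additive identity 0^C, and the multiplicative identity 1^C, is a commutative ring. -/
/-- The carrier of the covariance structure of degree `m` over `D`:
triples `(c, s, Q)` with `c : D`, `s` an `m`-vector over `D`, and `Q` an `m × m` matrix over `D`. -/
abbrev Cov (D : Type*) (m : ℕ) : Type _ := D × (Fin m → D) × Matrix (Fin m) (Fin m) D

/-- Addition `+^C` of the covariance structure: componentwise. -/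
def covAdd {D : Type*} [CommRing D] {m : ℕ} (a b : Cov D m) : Cov D m :=
  (a.1 + b.1, a.2.1 + b.2.1, a.2.2 + b.2.2)

/-- Multiplication `*^C` of the covariance structure. -/
def covMul {D : Type*} [CommRing D] {m : ℕ} (a b : Cov D m) : Cov D m :=
  (a.1 * b.1,
   b.1 • a.2.1 + a.1 • b.2.1,
   b.1 • a.2.2 + a.1 • b.2.2 + Matrix.vecMulVec a.2.1 b.2.1 + Matrix.vecMulVec b.2.1 a.2.1)

/-- The additive identity `0^C = (0, 0_{m×1}, 0_{m×m})`. -/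
def covZero (D : Type*) [CommRing D] (m : ℕ) : Cov D m := (0, 0, 0)

/-- The multiplicative identity `1^C = (1, 0_{m×1}, 0_{m×m})`. -/
def covOne (D : Type*) [CommRing D] (m : ℕ) : Cov D m := (1, 0, 0)

theorem Cov.ext_entries {D : Type*} {m : ℕ} {a b : Cov D m} (hc : a.1 = b.1)
    (hs : ∀ i, a.2.1 i = b.2.1 i) (hQ : ∀ i j, a.2.2 i j = b.2.2 i j) : a = b :=
  Prod.ext hc (Prod.ext (funext hs) (Matrix.ext hQ))

/-- The covariance structure of degree `m` over a commutative ring `D`, with operations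
`+^C` and `*^C` and identities `0^C` and `1^C`, is a commutative ring: all the
commutative ring axioms hold. -/
theorem covariance_structure_is_commutative_ring
    (D : Type*) [CommRing D] (m : ℕ) :
    (∀ a b : Cov D m, covAdd a b = covAdd b a) ∧
    (∀ a b c : Cov D m, covAdd (covAdd a b) c = covAdd a (covAdd b c)) ∧
    (∀ a : Cov D m, covAdd (covZero D m) a = a ∧ covAdd a (covZero D m) = a) ∧
    (∀ a : Cov D m, ∃ b : Cov D m,
      covAdd a b = covZero D m ∧ covAdd b a = covZero D m) ∧
    (∀ a b c : Cov D m, covMul (covMul a b) c = covMul a (covMul b c)) ∧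
    (∀ a : Cov D m, covMul a (covOne D m) = a ∧ covMul (covOne D m) a = a) ∧
    (∀ a b c : Cov D m,
      covMul a (covAdd b c) = covAdd (covMul a b) (covMul a c) ∧
      covMul (covAdd a b) c = covAdd (covMul a c) (covMul b c)) ∧
    (∀ a b : Cov D m, covMul a b = covMul b a) := by
  refine ⟨add_comm, add_assoc, fun a => ⟨zero_add a, add_zero a⟩,
    fun a => ⟨-a, add_neg_cancel a, neg_add_cancel a⟩, fun a b c => ?_, fun a => ⟨?_, ?_⟩,
    fun a b c => ⟨?_, ?_⟩, fun a b => ?_⟩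
  all_goals
    refine Cov.ext_entries ?_ (fun i => ?_) (fun i j => ?_) <;>
    simp only [covMul, covAdd, covOne, Pi.add_apply, Pi.smul_apply, Pi.zero_apply,
      Matrix.add_apply, Matrix.smul_apply, Matrix.zero_apply, Matrix.vecMulVec_apply,
      smul_eq_mul] <;>
    ring
end

section
/- The multiplication *^C of the covariance structure of degree m over a commutative ring D is associative: for all triples a, b, c in C, (a *^C b) *^C c = a *^C (b *^C c). -/
/-- The multiplication `*^C` of the covariance structure of degree `m` over a commutative
ring `D` is associative. -/
theorem covMul_assoc (D : Type*) [CommRing D] (m : ℕ) (a b c : Cov D m) :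
    covMul (covMul a b) c = covMul a (covMul b c) := by
  refine Prod.ext ?_ (Prod.ext ?_ ?_)
  · simp only [covMul]
    ring
  · ext i
    simp only [covMul, Pi.add_apply, Pi.smul_apply, smul_eq_mul]
    ring
  · ext i j
    simp only [covMul, Matrix.add_apply, Matrix.smul_apply, Matrix.vecMulVec_apply,
      Pi.add_apply, Pi.smul_apply, smul_eq_mul]
    ring
end
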